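/- Let G be a signed graph with edge set E, let B be a bond of G, let e ∈ B, and let A be any edge set with B ⊆ A ⊆ E. Then β(G−A) = β(G−(A∖{e})). In particular, β(G−B) = β(G−(B∖{e})) for every e ∈ B. -/

import Mathlib

/-- A signed graph: each edge `e` has endpoints `a e`, `b e` (equal for a loop)
and a sign `sign e ∈ {1, -1}`. -/
structure SignedGraph (V E : Type) where
  a : E → V
  b : E → V
  sign : E → ℤ
  sign_unit : ∀ e, sign e = 1 ∨ sign e = -1

namespace SignedGraph

variable {V E : Type}

/-- An orientation of a signed graph: incidence signs `ηa e`, `ηb e ∈ {1,-1}` at the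
two ends of each edge, with `ηa e * ηb e = - sign e`. -/
structure Orientation (G : SignedGraph V E) where
  ηa : E → ℤ
  ηb : E → ℤ
  ηa_unit : ∀ e, ηa e = 1 ∨ ηa e = -1
  ηb_unit : ∀ e, ηb e = 1 ∨ ηb e = -1
  compat : ∀ e, ηa e * ηb e = - G.sign e

/-- Kirchhoff's law at every vertex: a `Γ`-flow. -/
def IsFlow [Fintype E] [DecidableEq V] {Γ : Type} [AddCommGroup Γ]
    (G : SignedGraph V E) (O : G.Orientation) (f : E → Γ) : Prop :=
  ∀ v : V, ∑ e : E,
    ((if G.a e = v then O.ηa e else 0) + (if G.b e = v then O.ηb e else 0)) • f e = 0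

/-- Degree of a vertex in the subgraph with edge set `S` (a loop counts twice). -/
def deg [DecidableEq V] (G : SignedGraph V E) (S : Finset E) (v : V) : ℕ :=
  ∑ e ∈ S, ((if G.a e = v then 1 else 0) + (if G.b e = v then 1 else 0))

/-- Adjacency via an edge in the edge set `S`. -/
def AdjIn (G : SignedGraph V E) (S : Finset E) (v w : V) : Prop :=
  ∃ e ∈ S, (G.a e = v ∧ G.b e = w) ∨ (G.a e = w ∧ G.b e = v)

/-- A circuit: a nonempty edge set forming a connected 2-regular subgraph. -/
def IsCircuit [DecidableEq V] (G : SignedGraph V E) (C : Finset E) : Prop :=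
  C.Nonempty ∧
  (∀ v : V, (∃ e ∈ C, G.a e = v ∨ G.b e = v) → G.deg C v = 2) ∧
  (∀ v w : V, (∃ e ∈ C, G.a e = v ∨ G.b e = v) → (∃ e ∈ C, G.a e = w ∨ G.b e = w) →
     Relation.ReflTransGen (G.AdjIn C) v w)

/-- An unbalanced circuit: a circuit with an odd number of negative edges. -/
def IsUnbalancedCircuit [DecidableEq V] (G : SignedGraph V E) (C : Finset E) : Prop :=
  G.IsCircuit C ∧ Odd (C.filter (fun e => G.sign e = -1)).card

/-- The subgraph with edge set `S` is balanced (contains no unbalanced circuit). -/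
def BalancedOn [DecidableEq V] (G : SignedGraph V E) (S : Finset E) : Prop :=
  ∀ C : Finset E, C ⊆ S → ¬ G.IsUnbalancedCircuit C

/-- A balanced signed graph: contains no unbalanced circuit. -/
def Balanced [DecidableEq V] (G : SignedGraph V E) : Prop :=
  ∀ C : Finset E, ¬ G.IsUnbalancedCircuit C

/-- An unbalanced signed graph: contains an unbalanced circuit. -/
def Unbalanced [DecidableEq V] (G : SignedGraph V E) : Prop :=
  ∃ C : Finset E, G.IsUnbalancedCircuit C

/-- Adjacency in the whole signed graph. -/
def Adj (G : SignedGraph V E) (v w : V) : Prop :=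
  ∃ e : E, (G.a e = v ∧ G.b e = w) ∨ (G.a e = w ∧ G.b e = v)

/-- A connected signed graph: every two vertices are joined by a walk. -/
def Connected (G : SignedGraph V E) : Prop :=
  ∀ v w : V, Relation.ReflTransGen G.Adj v w

/-- The setoid on vertices whose classes are the connected components. -/
def compSetoid (G : SignedGraph V E) : Setoid V :=
  ⟨Relation.EqvGen G.Adj, Relation.EqvGen.is_equivalence _⟩

/-- The connected component of a vertex. -/
def component (G : SignedGraph V E) (v : V) : Quotient G.compSetoid :=
  Quotient.mk G.compSetoid v

/-- The number of vertices of a connected component. -/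
noncomputable def compN (G : SignedGraph V E) (q : Quotient G.compSetoid) : ℕ :=
  Nat.card {v : V // G.component v = q}

/-- The number of edges of a connected component. -/
noncomputable def compM (G : SignedGraph V E) (q : Quotient G.compSetoid) : ℕ :=
  Nat.card {e : E // G.component (G.a e) = q}

/-- The connected component `q` is unbalanced (contains an unbalanced circuit). -/
def CompUnbalanced [DecidableEq V] (G : SignedGraph V E) (q : Quotient G.compSetoid) : Prop :=
  ∃ C : Finset E, G.IsUnbalancedCircuit C ∧ ∃ e ∈ C, G.component (G.a e) = q

open Classical in
/-- `β` of a connected component: `m - n` if unbalanced, `m - n + 1` if balanced. -/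
noncomputable def compBeta [DecidableEq V] (G : SignedGraph V E)
    (q : Quotient G.compSetoid) : ℕ :=
  if G.CompUnbalanced q then G.compM q - G.compN q else G.compM q + 1 - G.compN q

/-- `β(G)`: the sum of `β(ω)` over the connected components `ω` of `G`. -/
noncomputable def beta [DecidableEq V] (G : SignedGraph V E) : ℕ :=
  ∑ᶠ q : Quotient G.compSetoid, G.compBeta q

/-- `κ(G)`: the number of unbalanced connected components of `G`. -/
noncomputable def kappa [DecidableEq V] (G : SignedGraph V E) : ℕ :=
  Nat.card {q : Quotient G.compSetoid // G.CompUnbalanced q}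

/-- The signed graph `G - F` obtained by deleting the edges in `F` (all vertices kept). -/
def delete [DecidableEq E] (G : SignedGraph V E) (F : Finset E) :
    SignedGraph V {e : E // e ∉ F} :=
  ⟨fun e => G.a e.1, fun e => G.b e.1, fun e => G.sign e.1, fun e => G.sign_unit e.1⟩

/-- The edges with both endpoints in `X` (the edge set of `G[X]`). -/
def insideEdges [Fintype E] [DecidableEq V] (G : SignedGraph V E) (X : Finset V) : Finset E :=
  Finset.univ.filter (fun e => G.a e ∈ X ∧ G.b e ∈ X)

/-- The edges with one endpoint in `X` and one outside: `[X, Xᶜ]`. -/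
def crossEdges [Fintype E] [DecidableEq V] (G : SignedGraph V E) (X : Finset V) : Finset E :=
  Finset.univ.filter (fun e => (G.a e ∈ X ∧ G.b e ∉ X) ∨ (G.a e ∉ X ∧ G.b e ∈ X))

/-- A cut: a nonempty set `B = [X, Xᶜ] ∪ E_X` where `X` is a nonempty vertex set and `E_X`
is a set of edges of `G[X]` minimal with `G[X] - E_X` balanced. -/
def IsCut [Fintype E] [DecidableEq V] [DecidableEq E]
    (G : SignedGraph V E) (B : Finset E) : Prop :=
  B.Nonempty ∧ ∃ X : Finset V, X.Nonempty ∧ ∃ EX : Finset E,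
    EX ⊆ G.insideEdges X ∧
    G.BalancedOn (G.insideEdges X \ EX) ∧
    (∀ EX' ⊆ EX, G.BalancedOn (G.insideEdges X \ EX') → EX' = EX) ∧
    B = G.crossEdges X ∪ EX

/-- A bond: a cut that is minimal (under inclusion) among cuts. -/
def IsBond [Fintype E] [DecidableEq V] [DecidableEq E]
    (G : SignedGraph V E) (B : Finset E) : Prop :=
  G.IsCut B ∧ ∀ B' ⊆ B, G.IsCut B' → B' = B

/-- A broken bond: a bond minus its largest edge (w.r.t. the linear order on `E`). -/
def IsBrokenBond [Fintype E] [DecidableEq V] [LinearOrder E]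
    (G : SignedGraph V E) (D : Finset E) : Prop :=
  ∃ B : Finset E, G.IsBond B ∧ ∃ h : B.Nonempty, D = B.erase (B.max' h)

/-- `F` contains no broken bond of `G` as a subset. -/
def NoBrokenBond [Fintype E] [DecidableEq V] [LinearOrder E]
    (G : SignedGraph V E) (F : Finset E) : Prop :=
  ∀ D : Finset E, G.IsBrokenBond D → ¬ D ⊆ F

end SignedGraph

/-- `ε(Γ)`: the largest `d` such that `Γ` has a subgroup isomorphic to `(ℤ/2ℤ)^d`. -/
noncomputable def epsilon (Γ : Type) [AddCommGroup Γ] [Fintype Γ] : ℕ :=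
  sSup {d : ℕ | ∃ H : AddSubgroup Γ, Nonempty (H ≃+ (Fin d → ZMod 2))}

namespace SignedGraph

variable {V E : Type}

lemma AdjIn.symm {G : SignedGraph V E} {S : Finset E} {x y : V} (h : G.AdjIn S x y) :
    G.AdjIn S y x := by
  obtain ⟨e, he, h⟩ := h
  exact ⟨e, he, h.symm⟩

section Paths

variable [DecidableEq V] [DecidableEq E]

/-- `G.IsPath u W C v`: the edge set `C` forms a path from `u` to `v` with vertex set `W`. -/
inductive IsPath (G : SignedGraph V E) : V → Finset V → Finset E → V → Prop
  | nil (u : V) : IsPath G u {u} ∅ u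
  | cons {u w v : V} {W : Finset V} {C : Finset E} (e : E)
      (he : (G.a e = u ∧ G.b e = w) ∨ (G.a e = w ∧ G.b e = u))
      (p : IsPath G w W C v) (hu : u ∉ W) : IsPath G u (insert u W) (insert e C) v

variable {G : SignedGraph V E} {u v : V} {W : Finset V} {C : Finset E}

lemma IsPath.start_mem (p : G.IsPath u W C v) : u ∈ W := by
  cases p <;> simp

lemma IsPath.end_mem (p : G.IsPath u W C v) : v ∈ W := by
  induction p with
  | nil u => simp
  | cons e he p hu ih => exact Finset.mem_insert_of_mem ih

lemma IsPath.ends_mem (p : G.IsPath u W C v) : ∀ e ∈ C, G.a e ∈ W ∧ G.b e ∈ W := by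
  induction p with
  | nil u => simp
  | cons e he p hu ih =>
    intro f hf
    have := p.start_mem
    rcases Finset.mem_insert.1 hf with rfl | hf
    · rcases he with ⟨rfl, rfl⟩ | ⟨rfl, rfl⟩ <;> simp [this]
    · exact ⟨Finset.mem_insert_of_mem (ih f hf).1, Finset.mem_insert_of_mem (ih f hf).2⟩

lemma IsPath.exists_suffix (p : G.IsPath u W C v) :
    ∀ x ∈ W, ∃ W' C', C' ⊆ C ∧ G.IsPath x W' C' v := by
  induction p with
  | nil u =>
    intro x hx
    obtain rfl := Finset.mem_singleton.1 hx
    exact ⟨_, _, subset_rfl, .nil x⟩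
  | cons e he p hu ih =>
    intro x hx
    rcases Finset.mem_insert.1 hx with rfl | hx
    · exact ⟨_, _, subset_rfl, .cons e he p hu⟩
    · obtain ⟨W', C', hC, q⟩ := ih x hx
      exact ⟨W', C', hC.trans (Finset.subset_insert _ _), q⟩

lemma exists_isPath {S : Finset E} (h : Relation.ReflTransGen (G.AdjIn S) u v) :
    ∃ W C, C ⊆ S ∧ G.IsPath u W C v := by
  induction h using Relation.ReflTransGen.head_induction_on with
  | refl => exact ⟨_, _, Finset.empty_subset _, .nil v⟩
  | @head x y hxy _ ih =>
    obtain ⟨W, C, hC, p⟩ := ih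
    obtain ⟨e, heS, he⟩ := hxy
    by_cases hx : x ∈ W
    · obtain ⟨W', C', hC', q⟩ := p.exists_suffix x hx
      exact ⟨W', C', hC'.trans hC, q⟩
    · exact ⟨_, _, Finset.insert_subset heS hC, .cons e he p hx⟩

lemma IsPath.deg_add (p : G.IsPath u W C v) (x : V) :
    G.deg C x + (if u = x then 1 else 0) + (if v = x then 1 else 0) =
      if x ∈ W then 2 else 0 := by
  induction p with
  | nil u =>
    simp only [deg, Finset.sum_empty, Finset.mem_singleton]
    grind
  | @cons u w v W C e he p hu ih =>
    have heC : e ∉ C := fun h => by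
      have := p.ends_mem e h
      rcases he with ⟨rfl, rfl⟩ | ⟨rfl, rfl⟩ <;> tauto
    have hv := p.end_mem
    have hw := p.start_mem
    simp only [deg, Finset.sum_insert heC, Finset.mem_insert] at ih ⊢
    rcases he with ⟨rfl, rfl⟩ | ⟨rfl, rfl⟩ <;> grind

lemma IsPath.reachable (p : G.IsPath u W C v) :
    ∀ x ∈ W, Relation.ReflTransGen (G.AdjIn C) u x := by
  induction p with
  | nil u =>
    intro x hx
    obtain rfl := Finset.mem_singleton.1 hx
    exact .refl
  | cons e he p hu ih =>
    intro x hx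
    rcases Finset.mem_insert.1 hx with rfl | hx
    · exact .refl
    · refine .head ⟨e, Finset.mem_insert_self _ _, he⟩
        (Relation.ReflTransGen.mono ?_ _ _ (ih x hx))
      rintro y z ⟨f, hf, h⟩
      exact ⟨f, Finset.mem_insert_of_mem hf, h⟩

/-- A path together with an edge joining its ends is a circuit. -/
lemma IsPath.isCircuit_insert {e : E} (p : G.IsPath (G.a e) W C (G.b e)) (heC : e ∉ C) :
    G.IsCircuit (insert e C) := by
  have hW : ∀ x, (∃ f ∈ insert e C, G.a f = x ∨ G.b f = x) → x ∈ W := by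
    rintro x ⟨f, hf, h⟩
    rcases Finset.mem_insert.1 hf with rfl | hf
    · rcases h with rfl | rfl
      exacts [p.start_mem, p.end_mem]
    · rcases h with rfl | rfl
      exacts [(p.ends_mem f hf).1, (p.ends_mem f hf).2]
  have hreach : ∀ x ∈ W, Relation.ReflTransGen (G.AdjIn (insert e C)) (G.a e) x := fun x hx =>
    Relation.ReflTransGen.mono (fun y z ⟨f, hf, h⟩ => ⟨f, Finset.mem_insert_of_mem hf, h⟩) _ _
      (p.reachable x hx)
  refine ⟨Finset.insert_nonempty _ _, fun x hx => ?_, fun x y hx hy => ?_⟩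
  · have := p.deg_add x
    rw [if_pos (hW x hx)] at this
    simp only [deg, Finset.sum_insert heC] at this ⊢
    omega
  · have : Std.Symm (G.AdjIn (insert e C)) := ⟨fun _ _ => AdjIn.symm⟩
    exact (Std.Symm.symm _ _ (hreach x (hW x hx))).trans (hreach y (hW y hy))

lemma IsPath.prod_sign (p : G.IsPath u W C v) {s : V → ℤ} (hs : ∀ x, s x = 1 ∨ s x = -1)
    (hC : ∀ e ∈ C, s (G.a e) = G.sign e * s (G.b e)) : ∏ e ∈ C, G.sign e = s u * s v := by
  induction p with
  | nil u => rcases hs u with h | h <;> simp [h]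
  | @cons u w v W C e he p hu ih =>
    have heC : e ∉ C := fun h => by
      have := p.ends_mem e h
      rcases he with ⟨rfl, rfl⟩ | ⟨rfl, rfl⟩ <;> tauto
    rw [Finset.prod_insert heC, ih fun f hf => hC f (Finset.mem_insert_of_mem hf)]
    have h := hC e (Finset.mem_insert_self _ _)
    rcases he with ⟨rfl, rfl⟩ | ⟨rfl, rfl⟩
    · rw [h]; ring
    · rw [h]
      rcases G.sign_unit e with h' | h' <;> simp [h']

end Paths

lemma prod_sign_eq (G : SignedGraph V E) (C : Finset E) :
    ∏ e ∈ C, G.sign e = (-1) ^ (C.filter (fun e => G.sign e = -1)).card := by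
  rw [← Finset.prod_const, Finset.prod_filter]
  refine Finset.prod_congr rfl fun e _ => ?_
  rcases G.sign_unit e with h | h <;> simp [h]

/-- A balanced edge set admits a switching function making all its edges positive. -/
theorem BalancedOn.exists_switching [DecidableEq V] [DecidableEq E] {G : SignedGraph V E}
    {S : Finset E} (hS : G.BalancedOn S) :
    ∃ s : V → ℤ, (∀ x, s x = 1 ∨ s x = -1) ∧ ∀ e ∈ S, s (G.a e) = G.sign e * s (G.b e) := by
  classical
  induction S using Finset.induction_on with
  | empty => exact ⟨fun _ => 1, by simp⟩
  | insert e S heS ih =>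
    obtain ⟨s, hs, hsS⟩ := ih fun C hC => hS C (hC.trans (Finset.subset_insert _ _))
    by_cases hse : s (G.a e) = G.sign e * s (G.b e)
    · exact ⟨s, hs, by simpa [hse] using hsS⟩
    have hneg : s (G.a e) = -(G.sign e * s (G.b e)) := by
      rcases hs (G.a e) with h1 | h1 <;> rcases hs (G.b e) with h2 | h2 <;>
        rcases G.sign_unit e with h3 | h3 <;> simp_all
    by_cases hr : Relation.ReflTransGen (G.AdjIn S) (G.a e) (G.b e)
    · exfalso
      obtain ⟨W, C, hC, p⟩ := exists_isPath hr
      have heC : e ∉ C := fun h => heS (hC h)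
      refine hS _ (Finset.insert_subset_insert e hC) ⟨p.isCircuit_insert heC, ?_⟩
      have h1 : ∏ f ∈ insert e C, G.sign f = -1 := by
        rw [Finset.prod_insert heC, p.prod_sign hs fun f hf => hsS f (hC hf), hneg]
        rcases hs (G.b e) with h2 | h2 <;> rcases G.sign_unit e with h3 | h3 <;> simp [h2, h3]
      rw [prod_sign_eq] at h1
      by_contra hodd
      rw [Nat.not_odd_iff_even] at hodd
      rw [hodd.neg_one_pow] at h1
      norm_num at h1
    · refine ⟨fun x => if Relation.ReflTransGen (G.AdjIn S) (G.a e) x then -s x else s x,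
        fun x => ?_, fun f hf => ?_⟩
      · have := hs x
        dsimp only
        split_ifs <;> omega
      · rcases Finset.mem_insert.1 hf with rfl | hf
        · simp [Relation.ReflTransGen.refl, hr, hneg]
        · have hiff : Relation.ReflTransGen (G.AdjIn S) (G.a e) (G.a f) ↔
              Relation.ReflTransGen (G.AdjIn S) (G.a e) (G.b f) :=
            ⟨fun h => h.tail ⟨f, hf, .inl ⟨rfl, rfl⟩⟩, fun h => h.tail ⟨f, hf, .inr ⟨rfl, rfl⟩⟩⟩
          have := hsS f hf
          by_cases h : Relation.ReflTransGen (G.AdjIn S) (G.a e) (G.b f) <;>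
            simp [hiff, h, this]

/-- The linear functional measuring the failure of `φ` to be compatible with the edge `e`. -/
def edgeForm (G : SignedGraph V E) (e : E) : (V → ℚ) →ₗ[ℚ] ℚ :=
  LinearMap.proj (G.a e) - (G.sign e : ℚ) • LinearMap.proj (G.b e)

lemma edgeForm_eq_zero {G : SignedGraph V E} {e : E} {φ : V → ℚ} :
    G.edgeForm e φ = 0 ↔ φ (G.a e) = G.sign e * φ (G.b e) := by
  simp [edgeForm, sub_eq_zero]

/-- The rational functions on the vertices that are compatible with every edge: the left kernel
of the incidence matrix. -/
def potentials (G : SignedGraph V E) : Submodule ℚ (V → ℚ) :=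
  ⨅ e, LinearMap.ker (G.edgeForm e)

lemma mem_potentials {G : SignedGraph V E} {φ : V → ℚ} :
    φ ∈ G.potentials ↔ ∀ e, φ (G.a e) = G.sign e * φ (G.b e) := by
  simp [potentials, edgeForm_eq_zero]

lemma component_a_eq_component_b (G : SignedGraph V E) (e : E) :
    G.component (G.a e) = G.component (G.b e) :=
  Quotient.sound (Relation.EqvGen.rel _ _ ⟨e, .inl ⟨rfl, rfl⟩⟩)

lemma component_out (G : SignedGraph V E) (q : Quotient G.compSetoid) :
    G.component q.out = q :=
  Quotient.out_eq q

lemma eq_zero_iff_of_component_eq {G : SignedGraph V E} {φ : V → ℚ} (hφ : φ ∈ G.potentials)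
    {x y : V} (h : G.component x = G.component y) : φ x = 0 ↔ φ y = 0 := by
  rw [mem_potentials] at hφ
  replace h : Relation.EqvGen G.Adj x y := Quotient.exact h
  induction h with
  | rel x y h =>
    obtain ⟨e, h⟩ := h
    have := hφ e
    rcases h with ⟨rfl, rfl⟩ | ⟨rfl, rfl⟩ <;> rcases G.sign_unit e with h | h <;>
      simp [this, h]
  | refl => rfl
  | symm _ _ _ ih => exact ih.symm
  | trans _ _ _ _ _ ih₁ ih₂ => exact ih₁.trans ih₂

lemma prod_pow_deg [Fintype V] [DecidableEq V] (G : SignedGraph V E) (C : Finset E)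
    (φ : V → ℚ) : ∏ v, φ v ^ G.deg C v = ∏ e ∈ C, φ (G.a e) * φ (G.b e) := by
  simp only [deg, ← Finset.prod_pow_eq_pow_sum]
  rw [Finset.prod_comm]
  refine Finset.prod_congr rfl fun e _ => ?_
  simp only [pow_add, Finset.prod_mul_distrib]
  simp [pow_ite]

/-- A function compatible with all edges of an unbalanced circuit vanishes somewhere on it. -/
lemma IsUnbalancedCircuit.exists_eq_zero [Fintype V] [DecidableEq V] {G : SignedGraph V E}
    {C : Finset E} (hC : G.IsUnbalancedCircuit C) {φ : V → ℚ}
    (hφ : ∀ e ∈ C, φ (G.a e) = G.sign e * φ (G.b e)) : ∃ e ∈ C, φ (G.b e) = 0 := by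
  obtain ⟨⟨-, hdeg, -⟩, hodd⟩ := hC
  by_contra! hb
  have hpos : 0 ≤ ∏ v, φ v ^ G.deg C v := by
    refine Finset.prod_nonneg fun v _ => ?_
    by_cases hv : ∃ f ∈ C, G.a f = v ∨ G.b f = v
    · rw [hdeg v hv]
      positivity
    · have : G.deg C v = 0 := by
        refine Finset.sum_eq_zero fun f hf => ?_
        grind
      simp [this]
  have hneg : ∏ f ∈ C, φ (G.a f) * φ (G.b f) = -∏ f ∈ C, φ (G.b f) ^ 2 := by
    have h1 : ∏ f ∈ C, (G.sign f : ℚ) = -1 := by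
      have := G.prod_sign_eq C
      rw [hodd.neg_one_pow] at this
      exact_mod_cast this
    rw [← neg_one_mul, ← h1, ← Finset.prod_mul_distrib]
    refine Finset.prod_congr rfl fun f hf => ?_
    rw [hφ f hf]
    ring
  have hsq : 0 < ∏ f ∈ C, φ (G.b f) ^ 2 :=
    Finset.prod_pos fun f hf => by have := hb f hf; positivity
  rw [prod_pow_deg, hneg] at hpos
  linarith

lemma balancedOn_of_switching [Fintype V] [DecidableEq V] {G : SignedGraph V E} {S : Finset E}
    {s : V → ℤ} (hs : ∀ x, s x = 1 ∨ s x = -1)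
    (hS : ∀ e ∈ S, s (G.a e) = G.sign e * s (G.b e)) : G.BalancedOn S := by
  intro C hC hunb
  obtain ⟨e, -, he⟩ := hunb.exists_eq_zero (φ := fun x => (s x : ℚ))
    fun e he => by exact_mod_cast hS e (hC he)
  rcases hs (G.b e) with h | h <;> simp [h] at he

lemma eq_zero_of_compUnbalanced [Fintype V] [DecidableEq V] {G : SignedGraph V E} {φ : V → ℚ}
    (hφ : φ ∈ G.potentials) {x : V} (hx : G.CompUnbalanced (G.component x)) : φ x = 0 := by
  obtain ⟨C, hC, e, he, hex⟩ := hx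
  have hreach : ∀ y z, Relation.ReflTransGen (G.AdjIn C) y z → G.component y = G.component z := by
    intro y z h
    induction h with
    | refl => rfl
    | tail _ h ih =>
      obtain ⟨f, -, h⟩ := h
      exact ih.trans (Quotient.sound (Relation.EqvGen.rel _ _ ⟨f, h⟩))
  obtain ⟨f, hf, h0⟩ := hC.exists_eq_zero fun f _ => mem_potentials.1 hφ f
  have h1 := hreach _ _ (hC.1.2.2 (G.a e) (G.b f) ⟨e, he, .inl rfl⟩ ⟨f, hf, .inr rfl⟩)
  exact (eq_zero_iff_of_component_eq hφ (hex.symm.trans h1)).2 h0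

lemma finrank_potentials_delete [Fintype V] [DecidableEq E] {G : SignedGraph V E} {A : Finset E}
    {e : E} {φ : V → ℚ} (hφ : ∀ f ∉ A, G.edgeForm f φ = 0) (hφe : G.edgeForm e φ ≠ 0) :
    Module.finrank ℚ (G.delete A).potentials =
      Module.finrank ℚ (G.delete (A.erase e)).potentials + 1 := by
  let ℓ := (G.edgeForm e).domRestrict (G.delete A).potentials
  have hmem : φ ∈ (G.delete A).potentials :=
    mem_potentials.2 fun f => edgeForm_eq_zero.1 (hφ f.1 f.2)
  have hℓ : ℓ ≠ 0 := fun h => hφe (LinearMap.congr_fun h ⟨φ, hmem⟩)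
  have hker : (LinearMap.ker ℓ).map (G.delete A).potentials.subtype =
      (G.delete (A.erase e)).potentials := by
    ext ψ
    have h₁ : ψ ∈ (G.delete A).potentials ↔ ∀ f ∉ A, G.edgeForm f ψ = 0 := by
      simp [mem_potentials, edgeForm_eq_zero, delete]
    have h₂ : ψ ∈ (G.delete (A.erase e)).potentials ↔
        ∀ f ∉ A.erase e, G.edgeForm f ψ = 0 := by
      simp only [mem_potentials, edgeForm_eq_zero, delete, Subtype.forall]
    have h₃ : ψ ∈ (LinearMap.ker ℓ).map (G.delete A).potentials.subtype ↔
        ψ ∈ (G.delete A).potentials ∧ G.edgeForm e ψ = 0 := by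
      simp [ℓ, and_comm]
    rw [h₃, h₁, h₂]
    constructor
    · rintro ⟨h, h'⟩ f hf
      by_cases hfe : f = e
      · rwa [hfe]
      · exact h f fun hfA => hf (Finset.mem_erase.2 ⟨hfe, hfA⟩)
    · exact fun h => ⟨fun f hf => h f fun hf' => hf (Finset.mem_of_mem_erase hf'),
        h e (Finset.notMem_erase e A)⟩
  rw [← hker, Submodule.finrank_map_subtype_eq]
  exact (Module.Dual.finrank_ker_add_one_of_ne_zero hℓ).symm

section Beta

variable [Fintype V] [DecidableEq V] [Fintype E]

/-- The space of potentials has dimension the number of balanced components. -/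
theorem finrank_potentials (G : SignedGraph V E) :
    Module.finrank ℚ G.potentials =
      Nat.card {q : Quotient G.compSetoid // ¬ G.CompUnbalanced q} := by
  classical
  have := Fintype.ofFinite {q : Quotient G.compSetoid // ¬ G.CompUnbalanced q}
  let L : G.potentials →ₗ[ℚ] ({q : Quotient G.compSetoid // ¬ G.CompUnbalanced q} → ℚ) :=
    (LinearMap.pi fun q => LinearMap.proj q.1.out).domRestrict G.potentials
  have hL : ∀ φ q, L φ q = φ.1 q.1.out := fun _ _ => rfl
  have hinj : Function.Injective L := by
    rw [injective_iff_map_eq_zero]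
    rintro ⟨φ, hφ⟩ h0
    ext x
    by_cases hx : G.CompUnbalanced (G.component x)
    · exact eq_zero_of_compUnbalanced hφ hx
    · exact (eq_zero_iff_of_component_eq hφ (G.component_out _)).1 (congrFun h0 ⟨_, hx⟩)
  have hsurj : Function.Surjective L := by
    intro c
    have hbal : G.BalancedOn
        (Finset.univ.filter fun e => ¬ G.CompUnbalanced (G.component (G.a e))) := by
      intro C hC hunb
      obtain ⟨e, he⟩ := hunb.1.1
      exact (Finset.mem_filter.1 (hC he)).2 ⟨C, hunb, e, he, rfl⟩
    obtain ⟨s, hs, hsw⟩ := hbal.exists_switching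
    refine ⟨⟨fun x => if h : ¬ G.CompUnbalanced (G.component x) then
      c ⟨_, h⟩ * s x * s (G.component x).out else 0, mem_potentials.2 fun e => ?_⟩, ?_⟩
    · have hab := G.component_a_eq_component_b e
      by_cases h : G.CompUnbalanced (G.component (G.b e))
      · simp [hab, h]
      · have h1 : s (G.a e) = G.sign e * s (G.b e) :=
          hsw e (by simpa [hab] using h)
        simp only [hab, h, h1]
        simp only [not_false_eq_true, dite_true, Int.cast_mul]
        ring
    · ext q
      rw [hL]
      have hq := q.2
      simp only [component_out, hq, not_false_eq_true, dite_true]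
      rcases hs q.1.out with h | h <;> simp [h]
  rw [(LinearEquiv.ofBijective L ⟨hinj, hsurj⟩).finrank_eq, Module.finrank_fintype_fun_eq_card,
    Nat.card_eq_fintype_card]

open Classical in
lemma compN_le (G : SignedGraph V E) (q : Quotient G.compSetoid) :
    G.compN q ≤ G.compM q + if G.CompUnbalanced q then 0 else 1 := by
  let L : ({v : V // G.component v = q} → ℚ) →ₗ[ℚ] ({e : E // G.component (G.a e) = q} → ℚ) :=
    LinearMap.pi fun e => LinearMap.proj ⟨G.a e, e.2⟩ - (G.sign e : ℚ) •
      LinearMap.proj ⟨G.b e, (G.component_a_eq_component_b e).symm.trans e.2⟩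
  have key : ∀ φ, L φ = 0 → ∃ ψ ∈ G.potentials, ∀ x, φ x = ψ x.1 := by
    intro φ hφ
    refine ⟨fun x => if h : G.component x = q then φ ⟨x, h⟩ else 0,
      mem_potentials.2 fun e => ?_, fun x => by simp [x.2]⟩
    have hab := G.component_a_eq_component_b e
    by_cases h : G.component (G.a e) = q
    · have h0 := congrFun hφ ⟨e, h⟩
      simp only [h, hab ▸ h, dite_true]
      simpa [L, sub_eq_zero] using h0
    · have h' : ¬ G.component (G.b e) = q := hab ▸ h
      simp [h, h']
  simp only [compN, compM, Nat.card_eq_fintype_card]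
  rw [← Module.finrank_fintype_fun_eq_card ℚ (η := {v : V // G.component v = q}),
    ← Module.finrank_fintype_fun_eq_card ℚ (η := {e : E // G.component (G.a e) = q})]
  split_ifs with hq
  · refine LinearMap.finrank_le_finrank_of_injective (f := L) ?_
    rw [injective_iff_map_eq_zero]
    intro φ hφ
    obtain ⟨ψ, hψ, h⟩ := key φ hφ
    ext x
    rw [h]
    exact eq_zero_of_compUnbalanced hψ (x.2.symm ▸ hq)
  · have hinj : Function.Injective (L.prod (LinearMap.proj ⟨q.out, G.component_out q⟩)) := by
      rw [injective_iff_map_eq_zero]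
      intro φ hφ
      obtain ⟨h1, h2⟩ := Prod.mk.inj hφ
      obtain ⟨ψ, hψ, h⟩ := key φ h1
      ext x
      rw [h]
      refine (eq_zero_iff_of_component_eq hψ ((G.component_out q).trans x.2.symm)).1 ?_
      exact (h ⟨q.out, G.component_out q⟩).symm.trans h2
    simpa using LinearMap.finrank_le_finrank_of_injective hinj

/-- `β` is the corank of the incidence matrix. -/
theorem beta_add_card (G : SignedGraph V E) :
    G.beta + Fintype.card V = Fintype.card E + Module.finrank ℚ G.potentials := by
  classical
  have hV : Fintype.card V = ∑ q : Quotient G.compSetoid, G.compN q := by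
    simp only [compN, Nat.card_eq_fintype_card]
    rw [← Fintype.card_sigma]
    exact Fintype.card_congr (Equiv.sigmaFiberEquiv G.component).symm
  have hE : Fintype.card E = ∑ q : Quotient G.compSetoid, G.compM q := by
    simp only [compM, Nat.card_eq_fintype_card]
    rw [← Fintype.card_sigma]
    exact Fintype.card_congr (Equiv.sigmaFiberEquiv fun e => G.component (G.a e)).symm
  have hK : Module.finrank ℚ G.potentials =
      ∑ q : Quotient G.compSetoid, if G.CompUnbalanced q then 0 else 1 := by
    rw [finrank_potentials, Nat.card_eq_fintype_card, Fintype.card_subtype, Finset.card_filter]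
    simp only [ite_not]
  rw [beta, finsum_eq_sum_of_fintype, hV, hE, hK, ← Finset.sum_add_distrib,
    ← Finset.sum_add_distrib]
  refine Finset.sum_congr rfl fun q _ => ?_
  have := G.compN_le q
  rw [compBeta]
  split_ifs at this ⊢ <;> omega

variable [DecidableEq E]

/-- For each edge of a cut there is a function compatible with all edges outside the cut
but not with this edge. -/
lemma IsCut.exists_edgeForm_ne_zero {G : SignedGraph V E} {B : Finset E} (hB : G.IsCut B)
    {e : E} (he : e ∈ B) : ∃ φ : V → ℚ, (∀ f ∉ B, G.edgeForm f φ = 0) ∧ G.edgeForm e φ ≠ 0 := by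
  obtain ⟨-, X, -, EX, hEX, hbal, hmin, rfl⟩ := hB
  obtain ⟨s, hs, hsw⟩ := hbal.exists_switching
  have hsQ : ∀ x, (s x : ℚ) ≠ 0 := fun x => by rcases hs x with h | h <;> simp [h]
  have hσ : ∀ f, (G.sign f : ℚ) ≠ 0 := fun f => by
    rcases G.sign_unit f with h | h <;> simp [h]
  refine ⟨fun x => if x ∈ X then s x else 0, fun f hf => ?_, fun h0 => ?_⟩
  · rw [edgeForm_eq_zero]
    simp only [Finset.mem_union, not_or, crossEdges, Finset.mem_filter, Finset.mem_univ,
      true_and] at hf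
    by_cases ha : G.a f ∈ X <;> by_cases hb : G.b f ∈ X
    · have := hsw f (Finset.mem_sdiff.2 ⟨by simp [insideEdges, ha, hb], hf.2⟩)
      simp [ha, hb, this]
    · tauto
    · tauto
    · simp [ha, hb]
  · rw [edgeForm_eq_zero] at h0
    rcases Finset.mem_union.1 he with he | he
    · simp only [crossEdges, Finset.mem_filter, Finset.mem_univ, true_and] at he
      rcases he with ⟨ha, hb⟩ | ⟨ha, hb⟩
      · exact hsQ (G.a e) (by simpa [ha, hb] using h0)
      · exact mul_ne_zero (hσ e) (hsQ (G.b e)) (by simpa [ha, hb] using h0.symm)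
    · have hin := hEX he
      simp only [insideEdges, Finset.mem_filter, Finset.mem_univ, true_and] at hin
      simp only [hin.1, hin.2, if_true] at h0
      have hbal' : G.BalancedOn (G.insideEdges X \ EX.erase e) := by
        refine balancedOn_of_switching hs fun f hf => ?_
        obtain ⟨hf1, hf2⟩ := Finset.mem_sdiff.1 hf
        by_cases hfe : f = e
        · subst hfe
          exact_mod_cast h0
        · exact hsw f (Finset.mem_sdiff.2 ⟨hf1, fun h => hf2 (Finset.mem_erase.2 ⟨hfe, h⟩)⟩)
      exact Finset.notMem_erase e EX
        ((hmin _ (Finset.erase_subset e EX) hbal').symm ▸ he)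

end Beta

end SignedGraph

/-- If `B` is a bond of `G`, `e ∈ B` and `B ⊆ A ⊆ E`, then
`β(G - A) = β(G - (A ∖ {e}))`. -/
theorem beta_delete_erase {V E : Type}
    [Fintype V] [DecidableEq V] [Fintype E] [DecidableEq E]
    (G : SignedGraph V E) (B : Finset E) (hB : G.IsBond B)
    (e : E) (he : e ∈ B) (A : Finset E) (hBA : B ⊆ A) :
    (G.delete A).beta = (G.delete (A.erase e)).beta := by
  obtain ⟨φ, hφ, hφe⟩ := hB.1.exists_edgeForm_ne_zero he
  have hrank := SignedGraph.finrank_potentials_delete (fun f hf => hφ f fun h => hf (hBA h))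
    hφe
  have h₁ := (G.delete A).beta_add_card
  have h₂ := (G.delete (A.erase e)).beta_add_card
  have hcard : Fintype.card {f // f ∉ A.erase e} = Fintype.card {f // f ∉ A} + 1 := by
    have h₃ := Finset.card_erase_add_one (hBA he)
    have h₄ := Finset.card_le_univ A
    simp only [Fintype.card_subtype_compl, Fintype.card_coe]
    omega
  omega
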